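/- arXiv:1808.03961 — 4 statements merged into one kernel-verified Lean document; each statement's English description precedes it below -/
import Mathlib

section
/- Let H₁ and H₂ be complex Hilbert spaces. Let A : H₁ → H₁ be a bounded operator with bounded inverse satisfying ‖A⁻¹‖ ≤ a, and let B : H₂ → H₁ and E : H₁ → H₂ be bounded operators with ‖B‖ ≤ b and ‖E‖ ≤ b. Let D₀ ⊆ H₂ be a linear subspace and D : D₀ → H₂ a linear map possessing a bounded everywhere-defined inverse J : H₂ → H₂ (J(Dv) = v for v ∈ D₀; for every w ∈ H₂, Jw ∈ D₀ and D(Jw) = w) with ‖J‖ ≤ δ, and assume 2δab² ≤ 1. Then the block operator T : H₁ × D₀ → H₁ × H₂ defined by T(u, v) = (Au + Bv, Eu + Dv) is a bijection onto H₁ × H₂, its inverse is bounded, and for all (f, g) ∈ H₁ × H₂ one has ‖T⁻¹(f, g) − (A⁻¹f, 0)‖ ≤ 2(1 + ab)²·δ·‖(f, g)‖. -/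
/-- A priori bound for the second component of a solution of a block system whose Schur
complement is a small perturbation of an operator with left inverse `J`. -/
lemma norm_le_of_block_system {𝕜 X Y : Type*} [NontriviallyNormedField 𝕜]
    [NormedAddCommGroup X] [NormedSpace 𝕜 X] [NormedAddCommGroup Y] [NormedSpace 𝕜 Y]
    {A' : X →L[𝕜] X} {B : Y →L[𝕜] X} {E : X →L[𝕜] Y} {J : Y →L[𝕜] Y} {a b δ : ℝ}
    (ha : ‖A'‖ ≤ a) (hB : ‖B‖ ≤ b) (hE : ‖E‖ ≤ b) (hJ : ‖J‖ ≤ δ)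
    (hsmall : 2 * δ * a * b ^ 2 ≤ 1) {f u : X} {g v : Y}
    (hu : u = A' f - A' (B v)) (hv : v = J (g - E u)) :
    ‖v‖ ≤ 2 * δ * (‖g‖ + a * b * ‖f‖) := by
  have hb0 : 0 ≤ b := (norm_nonneg _).trans hB
  have ha0 : 0 ≤ a := (norm_nonneg _).trans ha
  have hδ0 : 0 ≤ δ := (norm_nonneg _).trans hJ
  have hu' : ‖u‖ ≤ a * (‖f‖ + b * ‖v‖) := by
    rw [hu, ← map_sub]
    refine (A'.le_of_opNorm_le ha _).trans ?_
    gcongr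
    exact (norm_sub_le _ _).trans (by gcongr; exact B.le_of_opNorm_le hB v)
  have hv' : ‖v‖ ≤ δ * (‖g‖ + b * (a * (‖f‖ + b * ‖v‖))) := by
    conv_lhs => rw [hv]
    refine (J.le_of_opNorm_le hJ _).trans ?_
    gcongr
    refine (norm_sub_le _ _).trans ?_
    gcongr
    exact (E.le_of_opNorm_le hE u).trans (by gcongr)
  nlinarith [mul_le_mul_of_nonneg_right hsmall (norm_nonneg v)]

/-- If `‖K‖ < 1` then `1 - K` is surjective. -/
lemma ContinuousLinearMap.exists_sub_apply_eq_of_norm_lt_one {𝕜 Y : Type*}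
    [NontriviallyNormedField 𝕜] [NormedAddCommGroup Y] [NormedSpace 𝕜 Y] [CompleteSpace Y]
    {K : Y →L[𝕜] Y} (hK : ‖K‖ < 1) (y : Y) : ∃ w, w - K w = y := by
  obtain ⟨U, hU⟩ := isUnit_one_sub_of_norm_lt_one hK
  refine ⟨(↑U⁻¹ : Y →L[𝕜] Y) y, ?_⟩
  have h := congrArg (fun L : Y →L[𝕜] Y => L y) U.mul_inv
  simpa [hU] using h


/-- Schur–Frobenius inversion estimate. Let `H₁`, `H₂` be complex Hilbert
spaces, `A : H₁ → H₁` bounded with bounded inverse `A'` of norm `≤ a`, `B : H₂ → H₁`,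
`E : H₁ → H₂` bounded of norm `≤ b`, `D₀ ⊆ H₂` a subspace and `Dop : D₀ → H₂` linear with
bounded everywhere-defined inverse `J` of norm `≤ δ`, and assume `2δab² ≤ 1`. Then the block
operator `T(u, v) = (Au + Bv, Eu + Dop v)` is a bijection of `H₁ × D₀` onto `H₁ × H₂`, its
inverse is bounded, and `‖T⁻¹(f, g) − (A⁻¹f, 0)‖ ≤ 2(1 + ab)²·δ·‖(f, g)‖`, the norm on the
product being the ℓ²-norm. -/
theorem schur_frobenius_inversion_estimate
    {H₁ H₂ : Type*}
    [NormedAddCommGroup H₁] [InnerProductSpace ℂ H₁] [CompleteSpace H₁]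
    [NormedAddCommGroup H₂] [InnerProductSpace ℂ H₂] [CompleteSpace H₂]
    (A A' : H₁ →L[ℂ] H₁)
    (hA1 : ∀ u, A' (A u) = u) (hA2 : ∀ u, A (A' u) = u)
    (a : ℝ) (ha : ‖A'‖ ≤ a)
    (B : H₂ →L[ℂ] H₁) (E : H₁ →L[ℂ] H₂) (b : ℝ) (hB : ‖B‖ ≤ b) (hE : ‖E‖ ≤ b)
    (D₀ : Submodule ℂ H₂) (Dop : D₀ →ₗ[ℂ] H₂)
    (J : H₂ →L[ℂ] H₂) (δ : ℝ)
    (hJ1 : ∀ v : D₀, J (Dop v) = v)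
    (hJmem : ∀ w : H₂, J w ∈ D₀)
    (hJ2 : ∀ w : H₂, Dop ⟨J w, hJmem w⟩ = w)
    (hJδ : ‖J‖ ≤ δ)
    (hsmall : 2 * δ * a * b ^ 2 ≤ 1) :
    Function.Bijective
      (fun p : H₁ × D₀ => ((A p.1 + B (p.2 : H₂), E p.1 + Dop p.2) : H₁ × H₂)) ∧
    ∀ (f : H₁) (g : H₂) (u : H₁) (v : D₀),
      A u + B (v : H₂) = f → E u + Dop v = g →
      Real.sqrt (‖u - A' f‖ ^ 2 + ‖(v : H₂)‖ ^ 2) ≤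
        2 * (1 + a * b) ^ 2 * δ * Real.sqrt (‖f‖ ^ 2 + ‖g‖ ^ 2) := by
  have hb0 : 0 ≤ b := (norm_nonneg _).trans hB
  have ha0 : 0 ≤ a := (norm_nonneg _).trans ha
  have hδ0 : 0 ≤ δ := (norm_nonneg _).trans hJδ
  have key : ∀ (f : H₁) (g : H₂) (u : H₁) (v : D₀),
      A u + B (v : H₂) = f → E u + Dop v = g →
      Real.sqrt (‖u - A' f‖ ^ 2 + ‖(v : H₂)‖ ^ 2) ≤
        2 * (1 + a * b) ^ 2 * δ * Real.sqrt (‖f‖ ^ 2 + ‖g‖ ^ 2) := by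
    intro f g u v hf hg
    have hu : u = A' f - A' (B v) := by rw [← map_sub, ← hf, add_sub_cancel_right, hA1]
    have hv : (v : H₂) = J (g - E u) := by rw [← hg, add_sub_cancel_left, hJ1]
    have hvb := norm_le_of_block_system ha hB hE hJδ hsmall hu hv
    have hub : ‖u - A' f‖ ≤ a * b * ‖(v : H₂)‖ := by
      rw [hu, sub_sub_cancel_left, norm_neg, mul_assoc]
      exact (A'.le_of_opNorm_le ha _).trans (by gcongr; exact B.le_of_opNorm_le hB _)
    set N := Real.sqrt (‖f‖ ^ 2 + ‖g‖ ^ 2)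
    have hfN : ‖f‖ ≤ N := Real.le_sqrt_of_sq_le (by linarith [sq_nonneg ‖g‖])
    have hgN : ‖g‖ ≤ N := Real.le_sqrt_of_sq_le (by linarith [sq_nonneg ‖f‖])
    calc Real.sqrt (‖u - A' f‖ ^ 2 + ‖(v : H₂)‖ ^ 2)
        ≤ ‖u - A' f‖ + ‖(v : H₂)‖ := Real.sqrt_le_iff.2 ⟨by positivity, by
          nlinarith [mul_nonneg (norm_nonneg (u - A' f)) (norm_nonneg (v : H₂))]⟩
      _ ≤ (1 + a * b) * ‖(v : H₂)‖ := by linarith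
      _ ≤ (1 + a * b) * (2 * δ * (N + a * b * N)) := by
          gcongr
          exact hvb.trans (by gcongr)
      _ = 2 * (1 + a * b) ^ 2 * δ * N := by ring
  refine ⟨⟨?_, ?_⟩, key⟩
  · rintro ⟨u₁, v₁⟩ ⟨u₂, v₂⟩ h
    obtain ⟨h₁, h₂⟩ := Prod.mk.inj h
    have hz := key 0 0 (u₁ - u₂) (v₁ - v₂)
      (by
        rw [Submodule.coe_sub, map_sub, map_sub, sub_add_sub_comm]
        exact sub_eq_zero.2 h₁)
      (by
        rw [map_sub, map_sub, sub_add_sub_comm]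
        exact sub_eq_zero.2 h₂)
    have hz' : ‖u₁ - u₂‖ ^ 2 + ‖((v₁ - v₂ : D₀) : H₂)‖ ^ 2 ≤ 0 :=
      Real.sqrt_eq_zero'.1 (le_antisymm (by simpa using hz) (Real.sqrt_nonneg _))
    have hu : ‖u₁ - u₂‖ = 0 := by
      nlinarith [sq_nonneg ‖u₁ - u₂‖, sq_nonneg ‖((v₁ - v₂ : D₀) : H₂)‖]
    have hv : ‖((v₁ - v₂ : D₀) : H₂)‖ = 0 := by
      nlinarith [sq_nonneg ‖u₁ - u₂‖, sq_nonneg ‖((v₁ - v₂ : D₀) : H₂)‖]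
    rw [norm_eq_zero, sub_eq_zero] at hu
    rw [norm_eq_zero, Submodule.coe_eq_zero, sub_eq_zero] at hv
    rw [hu, hv]
  · rintro ⟨f, g⟩
    have hK : ‖E ∘L A' ∘L B ∘L J‖ < 1 := by
      refine lt_of_le_of_lt (b := b * (a * (b * δ))) ?_ (by linarith)
      refine (ContinuousLinearMap.opNorm_comp_le _ _).trans ?_
      gcongr
      refine (ContinuousLinearMap.opNorm_comp_le _ _).trans ?_
      gcongr
      exact (ContinuousLinearMap.opNorm_comp_le _ _).trans (by gcongr)
    obtain ⟨w, hw⟩ :=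
      ContinuousLinearMap.exists_sub_apply_eq_of_norm_lt_one hK (g - E (A' f))
    refine ⟨(A' (f - B (J w)), ⟨J w, hJmem w⟩), Prod.ext ?_ ?_⟩
    · simp [hA2]
    · simp only [ContinuousLinearMap.comp_apply] at hw
      simp only [hJ2, map_sub]
      rw [sub_add_eq_add_sub, add_sub_assoc, hw, add_sub_cancel]
end

section
/- Let H, Ĥ and 𝓗 be complex Hilbert spaces, let D be a linear subspace of H, and let A : D → H, Γ₀ : D → 𝓗, Γ₁ : D → 𝓗 be linear maps such that Γ₀ is surjective onto 𝓗 and the Green identity ⟨Au, v⟩_H − ⟨u, Av⟩_H = ⟨Γ₁u, Γ₀v⟩_𝓗 − ⟨Γ₀u, Γ₁v⟩_𝓗 holds for all u, v ∈ D. Let Π̂ : 𝓗 → Ĥ be a bounded operator with bounded inverse, and let 𝓑 : Ĥ → Ĥ be a bounded operator. Define the operator 𝓐 on the domain dom 𝓐 = {(u, Π̂(Γ₀u)) : u ∈ D} ⊆ H ⊕ Ĥ by 𝓐(u, û) = (Au, −(Π̂*)⁻¹(Γ₁u) + 𝓑û), where Π̂* : Ĥ → 𝓗 is the Hilbert-space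 adjoint of Π̂. Then 𝓐 is symmetric, i.e. ⟨𝓐x, y⟩ = ⟨x, 𝓐y⟩ for all x, y ∈ dom 𝓐, if and only if 𝓑 is self-adjoint in Ĥ. -/
open scoped ComplexInnerProductSpace

/-- Let `H`, `Ĥ`, `𝓗` be complex Hilbert spaces, `D ⊆ H`, and
`A : D → H`, `Γ₀ Γ₁ : D → 𝓗` linear, `Γ₀` surjective, satisfying the Green identity
`⟨Au, v⟩ − ⟨u, Av⟩ = ⟨Γ₁u, Γ₀v⟩ − ⟨Γ₀u, Γ₁v⟩`. Let `Π̂ : 𝓗 → Ĥ` be bounded with bounded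
inverse and `𝓑 : Ĥ → Ĥ` bounded. Define `𝓐` on
`dom 𝓐 = {(u, Π̂ Γ₀ u) : u ∈ D}` by `𝓐(u, û) = (Au, −(Π̂*)⁻¹ Γ₁ u + 𝓑 û)`, where
`(Π̂*)⁻¹` is the inverse `Q` of the adjoint `Π̂*`. Then `𝓐` is symmetric iff `𝓑` is
self-adjoint. (Inner products on direct sums are sums of componentwise inner products;
the paper's convention, linear in the first argument, is the complex conjugate of Mathlib's,
so the identities below are equivalent to the paper's.) -/
theorem dilation_symmetric_iff_selfAdjoint
    {H Hhat 𝓗 : Type*}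
    [NormedAddCommGroup H] [InnerProductSpace ℂ H] [CompleteSpace H]
    [NormedAddCommGroup Hhat] [InnerProductSpace ℂ Hhat] [CompleteSpace Hhat]
    [NormedAddCommGroup 𝓗] [InnerProductSpace ℂ 𝓗] [CompleteSpace 𝓗]
    (D : Submodule ℂ H) (A : D →ₗ[ℂ] H) (Γ₀ Γ₁ : D →ₗ[ℂ] 𝓗)
    (hΓ₀surj : Function.Surjective Γ₀)
    (hGreen : ∀ u v : D,
      ⟪A u, (v : H)⟫ - ⟪(u : H), A v⟫ = ⟪Γ₁ u, Γ₀ v⟫ - ⟪Γ₀ u, Γ₁ v⟫)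
    (Pihat : 𝓗 →L[ℂ] Hhat) (Piinv : Hhat →L[ℂ] 𝓗)
    (hPi1 : ∀ x : 𝓗, Piinv (Pihat x) = x) (hPi2 : ∀ y : Hhat, Pihat (Piinv y) = y)
    (Q : 𝓗 →L[ℂ] Hhat)
    (hQ1 : ∀ x : 𝓗, ContinuousLinearMap.adjoint Pihat (Q x) = x)
    (hQ2 : ∀ y : Hhat, Q (ContinuousLinearMap.adjoint Pihat y) = y)
    (𝓑 : Hhat →L[ℂ] Hhat) :
    (∀ u v : D,
        ⟪A u, (v : H)⟫ + ⟪-Q (Γ₁ u) + 𝓑 (Pihat (Γ₀ u)), Pihat (Γ₀ v)⟫ =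
        ⟪(u : H), A v⟫ + ⟪Pihat (Γ₀ u), -Q (Γ₁ v) + 𝓑 (Pihat (Γ₀ v))⟫) ↔
      IsSelfAdjoint 𝓑 := by
  have key (u v : D) :
      (⟪A u, (v : H)⟫ + ⟪-Q (Γ₁ u) + 𝓑 (Pihat (Γ₀ u)), Pihat (Γ₀ v)⟫ =
        ⟪(u : H), A v⟫ + ⟪Pihat (Γ₀ u), -Q (Γ₁ v) + 𝓑 (Pihat (Γ₀ v))⟫) ↔
      ⟪𝓑 (Pihat (Γ₀ u)), Pihat (Γ₀ v)⟫ = ⟪Pihat (Γ₀ u), 𝓑 (Pihat (Γ₀ v))⟫ := by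
    have hleft : ⟪Q (Γ₁ u), Pihat (Γ₀ v)⟫ = ⟪Γ₁ u, Γ₀ v⟫ := by
      rw [← ContinuousLinearMap.adjoint_inner_left, hQ1]
    have hright : ⟪Pihat (Γ₀ u), Q (Γ₁ v)⟫ = ⟪Γ₀ u, Γ₁ v⟫ := by
      rw [← ContinuousLinearMap.adjoint_inner_right, hQ1]
    rw [inner_add_left, inner_add_right, inner_neg_left, inner_neg_right, hleft, hright]
    have hG := hGreen u v
    constructor <;> intro h
    · linear_combination h - hG
    · linear_combination h + hG
  simp only [key]
  rw [ContinuousLinearMap.isSelfAdjoint_iff_isSymmetric]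
  refine ⟨fun h x y => ?_, fun h u v => h _ _⟩
  obtain ⟨u, hu⟩ := hΓ₀surj (Piinv x)
  obtain ⟨v, hv⟩ := hΓ₀surj (Piinv y)
  have huv := h u v
  rw [hu, hv, hPi2, hPi2] at huv
  exact huv
end

section
/- Let 𝓗, Ĥ and H be complex Hilbert spaces, let S : 𝓗 → H be a bounded operator, let Π̂ : 𝓗 → Ĥ be a bounded operator with bounded inverse, let 𝓑 : Ĥ → Ĥ be a bounded self-adjoint operator, and let z ∈ ℂ with Im z ≠ 0. Let W : 𝓗 → 𝓗 be a bounded operator such that Im⟨Wφ, φ⟩ = (Im z)·‖Sφ‖² for all φ ∈ 𝓗. Then the bounded operator V := W − Π̂*(𝓑 − z·I)Π̂ satisfies |Im⟨Vφ, φ⟩| ≥ |Im z|·‖Π̂⁻¹‖⁻²·‖φ‖² for all φ ∈ 𝓗, and consequently V is bijective with bounded inverse satisfying ‖V⁻¹‖ ≤ ‖Π̂⁻¹‖²/|Im z|. -/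
open scoped ComplexInnerProductSpace

/-- A bounded operator `T` with `|Im⟪x, T x⟫| ≥ c‖x‖²` for some `c > 0` is
invertible, with inverse of norm at most `c⁻¹`. -/
theorem exists_inverse_of_le_abs_im_inner {E : Type*} [NormedAddCommGroup E]
    [InnerProductSpace ℂ E] [CompleteSpace E] (T : E →L[ℂ] E) {c : ℝ} (hc : 0 < c)
    (h : ∀ x, c * ‖x‖ ^ 2 ≤ |(⟪x, T x⟫).im|) :
    ∃ T' : E →L[ℂ] E, ‖T'‖ ≤ c⁻¹ ∧ (∀ x, T' (T x) = x) ∧ ∀ x, T (T' x) = x := by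
  have hinner (x : E) : c * ‖x‖ ^ 2 ≤ ‖⟪x, T x⟫‖ := (h x).trans (Complex.abs_im_le_norm _)
  have hunit : IsUnit T :=
    T.isUnit_of_forall_le_norm_inner_map (c := ⟨c, hc.le⟩) hc fun x ↦ by
      rw [norm_inner_symm, mul_comm]
      exact hinner x
  obtain ⟨u, rfl⟩ := hunit
  have hright (x : E) : (u : E →L[ℂ] E) ((↑u⁻¹ : E →L[ℂ] E) x) = x :=
    DFunLike.congr_fun u.mul_inv x
  refine ⟨(↑u⁻¹ : E →L[ℂ] E), ContinuousLinearMap.opNorm_le_bound _ (inv_pos.2 hc).le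
    fun x ↦ ?_, fun x ↦ DFunLike.congr_fun u.inv_mul x, hright⟩
  set y := (↑u⁻¹ : E →L[ℂ] E) x with hy
  have hle : c * ‖y‖ ^ 2 ≤ ‖y‖ * ‖x‖ := by
    simpa only [hy, hright] using (hinner y).trans (norm_inner_le_norm _ _)
  rw [inv_mul_eq_div, le_div_iff₀ hc]
  rcases (norm_nonneg y).eq_or_lt with h0 | h0
  · simp [← h0]
  · nlinarith

/-- The quadratic form of a bounded self-adjoint operator is real. -/
theorem IsSelfAdjoint.im_inner_apply_eq_zero {E : Type*} [NormedAddCommGroup E]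
    [InnerProductSpace ℂ E] [CompleteSpace E] {A : E →L[ℂ] E} (hA : IsSelfAdjoint A) (x : E) :
    (⟪x, A x⟫).im = 0 :=
  hA.isSymmetric.im_inner_self_apply x

/-- Let `𝓗`, `Ĥ`, `H` be complex Hilbert spaces, `S : 𝓗 → H` bounded,
`Π̂ : 𝓗 → Ĥ` bounded with bounded inverse `Π̂⁻¹`, `𝓑 : Ĥ → Ĥ` bounded self-adjoint, and
`z ∈ ℂ` with `Im z ≠ 0`. Let `W : 𝓗 → 𝓗` be bounded with `Im⟨Wφ, φ⟩ = (Im z)‖Sφ‖²` for all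
`φ`. Then `V := W − Π̂*(𝓑 − z)Π̂` satisfies `|Im⟨Vφ, φ⟩| ≥ |Im z|·‖Π̂⁻¹‖⁻²·‖φ‖²`, and
consequently `V` is bijective with bounded inverse of norm `≤ ‖Π̂⁻¹‖²/|Im z|`.
(The paper's inner product, linear in the first argument, satisfies
`⟨Wφ, φ⟩ = ⟪φ, Wφ⟫` in Mathlib's convention.) -/
theorem coercivity_of_truncated_M_function
    {𝓗 Hhat H : Type*}
    [NormedAddCommGroup 𝓗] [InnerProductSpace ℂ 𝓗] [CompleteSpace 𝓗]
    [NormedAddCommGroup Hhat] [InnerProductSpace ℂ Hhat] [CompleteSpace Hhat]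
    [NormedAddCommGroup H] [InnerProductSpace ℂ H] [CompleteSpace H]
    (S : 𝓗 →L[ℂ] H)
    (Pihat : 𝓗 →L[ℂ] Hhat) (Piinv : Hhat →L[ℂ] 𝓗)
    (hPi1 : ∀ x : 𝓗, Piinv (Pihat x) = x) (hPi2 : ∀ y : Hhat, Pihat (Piinv y) = y)
    (𝓑 : Hhat →L[ℂ] Hhat) (h𝓑 : IsSelfAdjoint 𝓑)
    (z : ℂ) (hz : z.im ≠ 0)
    (W : 𝓗 →L[ℂ] 𝓗)
    (hW : ∀ φ : 𝓗, (⟪φ, W φ⟫).im = z.im * ‖S φ‖ ^ 2) :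
    (∀ φ : 𝓗,
      |z.im| * (‖Piinv‖ ^ 2)⁻¹ * ‖φ‖ ^ 2 ≤
        |(⟪φ, (W - (ContinuousLinearMap.adjoint Pihat).comp
            (((𝓑 - z • ContinuousLinearMap.id ℂ Hhat)).comp Pihat)) φ⟫).im|) ∧
    Function.Bijective
      (W - (ContinuousLinearMap.adjoint Pihat).comp
        (((𝓑 - z • ContinuousLinearMap.id ℂ Hhat)).comp Pihat)) ∧
    ∃ V' : 𝓗 →L[ℂ] 𝓗,
      ‖V'‖ ≤ ‖Piinv‖ ^ 2 / |z.im| ∧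
      (∀ φ : 𝓗, V' ((W - (ContinuousLinearMap.adjoint Pihat).comp
          (((𝓑 - z • ContinuousLinearMap.id ℂ Hhat)).comp Pihat)) φ) = φ) ∧
      (∀ φ : 𝓗, (W - (ContinuousLinearMap.adjoint Pihat).comp
          (((𝓑 - z • ContinuousLinearMap.id ℂ Hhat)).comp Pihat)) (V' φ) = φ) := by
  set V := W - (ContinuousLinearMap.adjoint Pihat).comp
    ((𝓑 - z • ContinuousLinearMap.id ℂ Hhat).comp Pihat) with hV
  have him (φ : 𝓗) : (⟪φ, V φ⟫).im = z.im * (‖S φ‖ ^ 2 + ‖Pihat φ‖ ^ 2) := by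
    have hB := h𝓑.im_inner_apply_eq_zero (Pihat φ)
    simp only [hV, sub_apply, ContinuousLinearMap.comp_apply,
      smul_apply, ContinuousLinearMap.id_apply, inner_sub_right,
      ContinuousLinearMap.adjoint_inner_right, inner_smul_right, Complex.sub_im, hW, hB,
      inner_self_eq_norm_sq_to_K, Complex.coe_algebraMap, ← Complex.ofReal_pow,
      Complex.im_mul_ofReal]
    ring
  have hnorm (φ : 𝓗) : ‖φ‖ ≤ ‖Piinv‖ * ‖Pihat φ‖ := by
    simpa only [hPi1] using Piinv.le_opNorm (Pihat φ)
  have hcoer (φ : 𝓗) : |z.im| * (‖Piinv‖ ^ 2)⁻¹ * ‖φ‖ ^ 2 ≤ |(⟪φ, V φ⟫).im| := by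
    have hPi : (‖Piinv‖ ^ 2)⁻¹ * ‖φ‖ ^ 2 ≤ ‖Pihat φ‖ ^ 2 := by
      rw [inv_mul_eq_div]
      refine div_le_of_le_mul₀ (by positivity) (by positivity) ?_
      rw [mul_comm, ← mul_pow]
      exact pow_le_pow_left₀ (norm_nonneg φ) (hnorm φ) 2
    rw [him, abs_mul, abs_of_nonneg (by positivity : 0 ≤ ‖S φ‖ ^ 2 + ‖Pihat φ‖ ^ 2), mul_assoc]
    gcongr
    exact hPi.trans (le_add_of_nonneg_left (by positivity))
  have hinv : ∃ V' : 𝓗 →L[ℂ] 𝓗, ‖V'‖ ≤ ‖Piinv‖ ^ 2 / |z.im| ∧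
      (∀ φ, V' (V φ) = φ) ∧ ∀ φ, V (V' φ) = φ := by
    rcases (norm_nonneg Piinv).eq_or_lt with h0 | h0
    · have hzero (φ : 𝓗) : φ = 0 := by simpa [← h0] using hnorm φ
      exact ⟨0, by rw [norm_zero]; positivity, fun φ ↦ (hzero _).trans (hzero _).symm,
        fun φ ↦ (hzero _).trans (hzero _).symm⟩
    · have hc : 0 < |z.im| * (‖Piinv‖ ^ 2)⁻¹ := by positivity
      obtain ⟨V', hle, hl, hr⟩ := exists_inverse_of_le_abs_im_inner V hc hcoer
      refine ⟨V', hle.trans_eq ?_, hl, hr⟩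
      rw [mul_inv, inv_inv, mul_comm, div_eq_mul_inv]
  obtain ⟨V', hle, hl, hr⟩ := hinv
  exact ⟨hcoer, ⟨Function.LeftInverse.injective hl, Function.RightInverse.surjective hr⟩,
    V', hle, hl, hr⟩
end

section
/- Let d ≥ 1 and let A be a real symmetric positive definite d×d matrix. Let M ≥ 0. Then there exists a constant C > 0 such that for all ε ∈ (0, 1], all m ∈ ℝ with |m| ≤ M, and all τ ∈ ℝ^d: |τ|·( 1 + (m − ε⁻²⟨τ, Aτ⟩)² )^{−1/2} ≤ C·ε. -/
/-- The quadratic form of a positive definite real matrix is coercive for the Euclidean norm. -/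
theorem Matrix.PosDef.exists_pos_mul_norm_sq_le {ι : Type*} [Fintype ι]
    {A : Matrix ι ι ℝ} (hA : A.PosDef) :
    ∃ c : ℝ, 0 < c ∧ ∀ x : EuclideanSpace ℝ ι,
      c * ‖x‖ ^ 2 ≤ ∑ i, ∑ j, x i * (A i j * x j) := by
  set Q : EuclideanSpace ℝ ι → ℝ := fun x => ∑ i, ∑ j, x i * (A i j * x j) with hQ
  have hQ_pos : ∀ x, x ≠ 0 → 0 < Q x := by
    intro x hx
    have hx' : x.ofLp ≠ 0 := fun h => hx (by ext i; exact congrFun h i)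
    simpa [hQ, dotProduct, Matrix.mulVec, Finset.mul_sum] using hA.re_dotProduct_pos hx'
  have hQ_smul : ∀ (a : ℝ) x, Q (a • x) = a ^ 2 * Q x := by
    intro a x
    simp only [hQ, PiLp.smul_apply, smul_eq_mul, Finset.mul_sum]
    refine Finset.sum_congr rfl fun i _ => Finset.sum_congr rfl fun j _ => ?_
    ring
  have hQ_cont : Continuous Q := by fun_prop
  have h_unit : ∃ c : ℝ, 0 < c ∧ ∀ y ∈ Metric.sphere (0 : EuclideanSpace ℝ ι) 1, c ≤ Q y := by
    rcases (Metric.sphere (0 : EuclideanSpace ℝ ι) 1).eq_empty_or_nonempty with h | h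
    · exact ⟨1, one_pos, by simp [h]⟩
    · obtain ⟨y, hy, hmin⟩ := (isCompact_sphere _ _).exists_isMinOn h hQ_cont.continuousOn
      exact ⟨Q y, hQ_pos y (ne_zero_of_mem_unit_sphere ⟨y, hy⟩), hmin⟩
  obtain ⟨c, hc, hcQ⟩ := h_unit
  refine ⟨c, hc, fun x => ?_⟩
  change c * ‖x‖ ^ 2 ≤ Q x
  rcases eq_or_ne x 0 with rfl | hx
  · simp [hQ]
  have hn : 0 < ‖x‖ := norm_pos_iff.mpr hx
  have h := hcQ (‖x‖⁻¹ • x) (by simp [norm_smul, hn.ne'])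
  rw [hQ_smul, inv_pow, inv_mul_eq_div, le_div_iff₀ (by positivity)] at h
  exact h

/-- Let `d ≥ 1` and `A` a real symmetric positive definite `d×d` matrix,
`M ≥ 0`. Then there exists `C > 0` such that for all `ε ∈ (0, 1]`, all `m ∈ ℝ` with
`|m| ≤ M`, and all `τ ∈ ℝ^d`:
`|τ|·(1 + (m − ε⁻²⟨τ, Aτ⟩)²)^{−1/2} ≤ C·ε`. -/
theorem uniform_symbol_estimate
    (d : ℕ) (hd : 1 ≤ d)
    (A : Matrix (Fin d) (Fin d) ℝ) (hAsymm : A.IsSymm) (hApos : A.PosDef)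
    (M : ℝ) (hM : 0 ≤ M) :
    ∃ C : ℝ, 0 < C ∧
      ∀ ε : ℝ, 0 < ε → ε ≤ 1 → ∀ m : ℝ, |m| ≤ M →
        ∀ τ : EuclideanSpace ℝ (Fin d),
          ‖τ‖ / Real.sqrt (1 + (m - (ε ^ 2)⁻¹ * ∑ i, ∑ j, τ i * (A i j * τ j)) ^ 2) ≤
            C * ε := by
  obtain ⟨c, hc, hcQ⟩ := hApos.exists_pos_mul_norm_sq_le
  refine ⟨√((M + 1) / c), by positivity, fun ε hε _ m hm τ => ?_⟩
  have hQ := hcQ τ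
  set Q := ∑ i, ∑ j, τ i * (A i j * τ j)
  set r := √(1 + (m - (ε ^ 2)⁻¹ * Q) ^ 2)
  have hr1 : 1 ≤ r := Real.one_le_sqrt.mpr (by nlinarith [sq_nonneg (m - (ε ^ 2)⁻¹ * Q)])
  have hqr : (ε ^ 2)⁻¹ * Q - m ≤ r := Real.le_sqrt_of_sq_le (by nlinarith)
  have hq : (ε ^ 2)⁻¹ * Q ≤ (M + 1) * r ^ 2 := by
    nlinarith [(abs_le.mp hm).2, mul_nonneg hM (sub_nonneg.mpr hr1)]
  rw [inv_mul_le_iff₀ (by positivity)] at hq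
  rw [div_le_iff₀ (by positivity)]
  refine (sq_le_sq₀ (norm_nonneg τ) (by positivity)).mp ?_
  rw [mul_pow, mul_pow, Real.sq_sqrt (by positivity), div_mul_eq_mul_div, div_mul_eq_mul_div,
    le_div_iff₀ hc]
  linarith
end
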